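/- The positive operator B = diag(5, 2, 2) on ℝ³ does not admit a rank-one decomposition corresponding to the sequence {4, 4, 1}; that is, there do not exist unit vectors x_1, x_2, x_3 in ℝ³ with B = 4(x_1 ⊗ x_1) + 4(x_2 ⊗ x_2) + (x_3 ⊗ x_3). -/

import Mathlib

open scoped InnerProductSpace

/-- The rank-one operator `u ⊗ v : x ↦ ⟨x, v⟩ u` (inner product linear in `x`). -/
noncomputable def rankOne (𝕜 : Type*) {E : Type*} [RCLike 𝕜] [NormedAddCommGroup E]
    [InnerProductSpace 𝕜 E] (u v : E) : E →L[𝕜] E :=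
  (innerSL 𝕜 v).smulRight u

theorem rankOne_apply (𝕜 : Type*) {E : Type*} [RCLike 𝕜] [NormedAddCommGroup E]
    [InnerProductSpace 𝕜 E] (u v x : E) : rankOne 𝕜 u v x = ⟪v, x⟫_𝕜 • u :=
  rfl

/-- In dimension at least three, any two vectors have a common nonzero orthogonal vector. -/
theorem exists_ne_zero_inner_eq_zero_of_two_lt_finrank {𝕜 E : Type*} [RCLike 𝕜]
    [NormedAddCommGroup E] [InnerProductSpace 𝕜 E] [FiniteDimensional 𝕜 E]
    (h : 2 < Module.finrank 𝕜 E) (u v : E) :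
    ∃ y : E, y ≠ 0 ∧ ⟪u, y⟫_𝕜 = 0 ∧ ⟪v, y⟫_𝕜 = 0 := by
  classical
  have hS : Submodule.span 𝕜 (({u, v} : Finset E) : Set E) ≠ ⊤ := by
    intro htop
    have h₁ := finrank_span_finset_le_card (R := 𝕜) ({u, v} : Finset E)
    rw [Set.finrank, htop, finrank_top] at h₁
    exact absurd (h₁.trans Finset.card_le_two) (by omega)
  rw [Ne, ← Submodule.orthogonal_eq_bot_iff] at hS
  obtain ⟨y, hy, hy0⟩ := Submodule.exists_mem_ne_zero_of_ne_bot hS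
  rw [Submodule.mem_orthogonal] at hy
  exact ⟨y, hy0, hy u (Submodule.subset_span (by simp)), hy v (Submodule.subset_span (by simp))⟩

theorem two_mul_norm_sq_le_inner_diagonal_522 (y : EuclideanSpace ℝ (Fin 3)) :
    2 * ‖y‖ ^ 2 ≤
      ⟪y, Matrix.toEuclideanCLM (𝕜 := ℝ) (Matrix.diagonal ![5, 2, 2]) y⟫_ℝ := by
  simp only [EuclideanSpace.real_norm_sq_eq, PiLp.inner_apply, Fin.sum_univ_three,
    Matrix.ofLp_toEuclideanCLM, Matrix.mulVec_diagonal]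
  simp
  nlinarith [sq_nonneg (y 0)]


/-- The positive operator `B = diag (5, 2, 2)` on `ℝ³` does not admit a rank-one decomposition
corresponding to the sequence `{4, 4, 1}`: there are no unit vectors `x₁, x₂, x₃` with
`B = 4 (x₁ ⊗ x₁) + 4 (x₂ ⊗ x₂) + (x₃ ⊗ x₃)`. -/
theorem no_rank_one_decomposition_diag_522 :
    ¬ ∃ x₁ x₂ x₃ : EuclideanSpace ℝ (Fin 3), ‖x₁‖ = 1 ∧ ‖x₂‖ = 1 ∧ ‖x₃‖ = 1 ∧
      (Matrix.toEuclideanCLM (𝕜 := ℝ) (Matrix.diagonal ![5, 2, 2])) =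
        (4 : ℝ) • rankOne ℝ x₁ x₁ + (4 : ℝ) • rankOne ℝ x₂ x₂ + rankOne ℝ x₃ x₃ := by
  rintro ⟨x₁, x₂, x₃, -, -, h₃, hB⟩
  obtain ⟨y, hy, hy₁, hy₂⟩ := exists_ne_zero_inner_eq_zero_of_two_lt_finrank (𝕜 := ℝ)
    (E := EuclideanSpace ℝ (Fin 3)) (by simp) x₁ x₂
  have hlow := two_mul_norm_sq_le_inner_diagonal_522 y
  have hinner : ⟪y, Matrix.toEuclideanCLM (𝕜 := ℝ) (Matrix.diagonal ![5, 2, 2]) y⟫_ℝ =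
      ⟪x₃, y⟫_ℝ ^ 2 := by
    rw [hB]
    simp [rankOne_apply, hy₁, hy₂, inner_smul_right, real_inner_comm x₃ y, sq]
  have hcs : ⟪x₃, y⟫_ℝ ^ 2 ≤ ‖y‖ ^ 2 := by
    refine sq_le_sq' ?_ ?_
    · simpa [h₃] using neg_le_of_abs_le (abs_real_inner_le_norm x₃ y)
    · simpa [h₃] using real_inner_le_norm x₃ y
  have hpos : 0 < ‖y‖ ^ 2 := by positivity
  linarith
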